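/- arXiv:1602.04653 — 2 statements merged into one kernel-verified Lean document; each statement's English description precedes it below -/
import Mathlib

section
/- (Hardy-type estimate.) Suppose h satisfies the uniform ellipticity bounds with constants ν, N, and suppose there are σ'∈(0,1) and C_R ≥ 0 such that |R_h(x)| ≤ C_R ⟨x⟩^{−(1+σ')}|x|^{−1} for all x≠0. There is an explicit constant c = c(ν,N) > 0 (depending only on ν and N) such that, if C_R < c, then for every m ≥ 0, every operator H as in the context, and every compactly supported smooth f:ℝ³→ℂ⁴, one has m² ∫_{M_h} |f|² + (c − C_R) ∫_{M_h} |f(x)|²/|x|² ≤ ∫_{M_h} |Hf|². -/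
noncomputable section
open MeasureTheory Real Set

abbrev Eu (n : ℕ) : Type := EuclideanSpace ℝ (Fin n)

def pd {n : ℕ} {F : Type*} [NormedAddCommGroup F] [NormedSpace ℝ F]
    (j : Fin n) (f : Eu n → F) (x : Eu n) : F :=
  fderiv ℝ f x (EuclideanSpace.single j 1)

def Chr {n : ℕ} (h : Eu n → Matrix (Fin n) (Fin n) ℝ) (i j k : Fin n) (x : Eu n) : ℝ :=
  (1/2) * ∑ l, (h x)⁻¹ i l *
    (pd j (fun y => h y l k) x + pd k (fun y => h y j l) x - pd l (fun y => h y j k) x)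

def Rscal {n : ℕ} (h : Eu n → Matrix (Fin n) (Fin n) ℝ) (x : Eu n) : ℝ :=
  ∑ j, ∑ k, (h x)⁻¹ j k *
    ((∑ i, pd i (fun y => Chr h i j k y) x) - (∑ i, pd k (fun y => Chr h i j i y) x)
      + (∑ i, ∑ l, Chr h l j k x * Chr h i i l x) - (∑ i, ∑ l, Chr h l j i x * Chr h i k l x))

def sdet {n : ℕ} (h : Eu n → Matrix (Fin n) (Fin n) ℝ) (x : Eu n) : ℝ := Real.sqrt (h x).det

def lapR {n : ℕ} (h : Eu n → Matrix (Fin n) (Fin n) ℝ) (f : Eu n → ℝ) (x : Eu n) : ℝ :=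
  (sdet h x)⁻¹ * ∑ j, pd j (fun y => sdet h y * ∑ k, (h y)⁻¹ j k * pd k f y) x

def lapC {n : ℕ} (h : Eu n → Matrix (Fin n) (Fin n) ℝ) (f : Eu n → ℂ) (x : Eu n) : ℂ :=
  ((sdet h x : ℝ) : ℂ)⁻¹ *
    ∑ j, pd j (fun y => ((sdet h y : ℝ) : ℂ) * ∑ k, (((h y)⁻¹ j k : ℝ) : ℂ) * pd k f y) x

def jap {n : ℕ} (x : Eu n) : ℝ := Real.sqrt (1 + ‖x‖ ^ 2)

def Hop (A : Fin 3 → Eu 3 → Fin 4 → Fin 4 → ℂ) (B : Eu 3 → Fin 4 → Fin 4 → ℂ)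
    (f : Eu 3 → Fin 4 → ℂ) (x : Eu 3) : Fin 4 → ℂ :=
  fun i => (∑ j, ∑ k, A j x i k * pd j f x k) + ∑ k, B x i k * f x k

def Elliptic (h : Eu 3 → Matrix (Fin 3) (Fin 3) ℝ) (ν N : ℝ) : Prop :=
  ∀ x : Eu 3, ∀ ξ : Fin 3 → ℝ,
    ν * (∑ j, ξ j ^ 2) ≤ (∑ j, ∑ k, (h x)⁻¹ j k * ξ j * ξ k) ∧
      (∑ j, ∑ k, (h x)⁻¹ j k * ξ j * ξ k) ≤ N * (∑ j, ξ j ^ 2)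

def opNorm {n : ℕ} (A : Matrix (Fin n) (Fin n) ℝ) : ℝ :=
  ‖LinearMap.toContinuousLinearMap (Matrix.toEuclideanLin A)‖

def pdM {n : ℕ} (j : Fin n) (H : Eu n → Matrix (Fin n) (Fin n) ℝ) (x : Eu n) :
    Matrix (Fin n) (Fin n) ℝ :=
  Matrix.of fun a b => pd j (fun y => H y a b) x

def AFlat (h : Eu 3 → Matrix (Fin 3) (Fin 3) ℝ) (σ CI Ch : ℝ) : Prop :=
  (∀ x : Eu 3, opNorm ((h x)⁻¹ - 1) ≤ CI * jap x ^ (-σ)) ∧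
  (∀ x : Eu 3,
    (∑ j, opNorm (pdM j (fun y => (h y)⁻¹) x))
      + ‖x‖ * (∑ j, ∑ k, opNorm (pdM j (pdM k (fun y => (h y)⁻¹)) x))
      + ‖x‖ ^ 2 * (∑ j, ∑ k, ∑ l, opNorm (pdM j (pdM k (pdM l (fun y => (h y)⁻¹))) x))
    ≤ Ch * jap x ^ (-(1 + σ)))

def sphInt (f : Eu 3 → ℝ) (R : ℝ) : ℝ :=
  R ^ 2 * ∫ ω : Metric.sphere (0 : Eu 3) 1, f (R • (ω : Eu 3)) ∂(volume.toSphere)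

def innC4 (h : Eu 3 → Matrix (Fin 3) (Fin 3) ℝ) (f g : Eu 3 → Fin 4 → ℂ) : ℂ :=
  ∫ x : Eu 3, (∑ i, (starRingEnd ℂ) (f x i) * g x i) * ((sdet h x : ℝ) : ℂ)

lemma integral_pd_eq_zero {n : ℕ} {F : Type*} [NormedAddCommGroup F] [NormedSpace ℝ F]
    (j : Fin n) {g : Eu n → F} (hg : ContDiff ℝ 1 g) (hc : HasCompactSupport g) :
    ∫ x, pd j g x = 0 := by
  have hd : Integrable (fun x => fderiv ℝ g x (EuclideanSpace.single j 1)) :=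
    ((hg.continuous_fderiv (by simp)).clm_apply continuous_const).integrable_of_hasCompactSupport
      (hc.fderiv_apply ℝ _)
  have key := integral_smul_fderiv_eq_neg_fderiv_smul_of_integrable (𝕜 := ℝ)
    (μ := (volume : Measure (Eu n))) (f := fun _ : Eu n => (1 : ℝ)) (g := g)
    (v := EuclideanSpace.single j 1) (by simp) (by simpa using hd)
    (by simpa using hg.continuous.integrable_of_hasCompactSupport hc) (by simp)
    (fun x _ => (hg.differentiable (by simp)) x)
  simpa [pd] using key

lemma contDiff_pd {n : ℕ} {F : Type*} [NormedAddCommGroup F] [NormedSpace ℝ F]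
    (j : Fin n) {g : Eu n → F} (hg : ContDiff ℝ (⊤ : ℕ∞) g) :
    ContDiff ℝ (⊤ : ℕ∞) (pd j g) :=
  (hg.fderiv_right (by simp)).clm_apply contDiff_const

lemma hasCompactSupport_pd {n : ℕ} {F : Type*} [NormedAddCommGroup F] [NormedSpace ℝ F]
    (j : Fin n) {g : Eu n → F} (hg : HasCompactSupport g) : HasCompactSupport (pd j g) :=
  hg.fderiv_apply ℝ _

lemma pd_mul {n : ℕ} {𝔸 : Type*} [NormedCommRing 𝔸] [NormedAlgebra ℝ 𝔸] (j : Fin n)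
    {f g : Eu n → 𝔸} {x : Eu n} (hf : DifferentiableAt ℝ f x) (hg : DifferentiableAt ℝ g x) :
    pd j (fun y => f y * g y) x = pd j f x * g x + f x * pd j g x := by
  simp only [pd]
  rw [fderiv_fun_mul hf hg]
  simp
  ring

lemma norm_sq_eq_sum {n : ℕ} (x : Eu n) : ‖x‖ ^ 2 = ∑ j, x j ^ 2 := by
  simp [EuclideanSpace.norm_sq_eq]

/-- The pointwise divergence of the Hardy vector field `u² x / (|x|² + ε)`. -/
lemma pd_hardyField {n : ℕ} (j : Fin n) {u : Eu n → ℝ} (hu : Differentiable ℝ u) {ε : ℝ}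
    (hε : 0 < ε) (x : Eu n) :
    pd j (fun y => u y ^ 2 * (y j * (‖y‖ ^ 2 + ε)⁻¹)) x
      = 2 * u x * pd j u x * (x j * (‖x‖ ^ 2 + ε)⁻¹)
        + u x ^ 2 * ((‖x‖ ^ 2 + ε)⁻¹ - 2 * x j ^ 2 * ((‖x‖ ^ 2 + ε)⁻¹) ^ 2) := by
  have hpos : ‖x‖ ^ 2 + ε ≠ 0 := by positivity
  have h1 : HasFDerivAt (fun y : Eu n => ‖y‖ ^ 2 + ε) (2 • innerSL ℝ x) x :=
    (hasStrictFDerivAt_norm_sq x).hasFDerivAt.add_const ε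
  have h2 := (hasDerivAt_inv hpos).comp_hasFDerivAt x h1
  have h3 : HasFDerivAt (fun y : Eu n => y j) (EuclideanSpace.proj j : Eu n →L[ℝ] ℝ) x :=
    (EuclideanSpace.proj j : Eu n →L[ℝ] ℝ).hasFDerivAt
  have h4 := ((hu x).hasFDerivAt.pow 2).mul (h3.mul h2)
  have h5 : fderiv ℝ (fun y => u y ^ 2 * (y j * (‖y‖ ^ 2 + ε)⁻¹)) x = _ := h4.fderiv
  rw [pd, h5]
  simp [pd, EuclideanSpace.inner_single_right]
  field_simp
  ring

lemma hardy_reg {u : Eu 3 → ℝ} (hu : ContDiff ℝ (⊤ : ℕ∞) u) (hc : HasCompactSupport u)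
    {ε : ℝ} (hε : 0 < ε) :
    ∫ x, u x ^ 2 * (‖x‖ ^ 2 + ε)⁻¹ ≤ 4 * ∫ x, ∑ j, pd j u x ^ 2 := by
  have hinv : ContDiff ℝ (⊤ : ℕ∞) (fun y : Eu 3 => (‖y‖ ^ 2 + ε)⁻¹) :=
    ContDiff.inv ((contDiff_norm_sq ℝ).add contDiff_const) (fun x => by positivity)
  have hcoord : ∀ j, ContDiff ℝ (⊤ : ℕ∞) (fun y : Eu 3 => y j) := fun j =>
    (EuclideanSpace.proj j : Eu 3 →L[ℝ] ℝ).contDiff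
  have hu2 : HasCompactSupport (fun x => u x ^ 2) :=
    hc.comp_left (g := fun t : ℝ => t ^ 2) (by simp)
  have hw : ∀ j, ContDiff ℝ (⊤ : ℕ∞) (fun y => u y ^ 2 * (y j * (‖y‖ ^ 2 + ε)⁻¹)) := fun j =>
    (hu.pow 2).mul ((hcoord j).mul hinv)
  have hwc : ∀ j, HasCompactSupport (fun y => u y ^ 2 * (y j * (‖y‖ ^ 2 + ε)⁻¹)) := fun j =>
    hu2.mul_right
  have hwi : ∀ j, Integrable (pd j (fun y => u y ^ 2 * (y j * (‖y‖ ^ 2 + ε)⁻¹))) := fun j =>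
    (contDiff_pd j (hw j)).continuous.integrable_of_hasCompactSupport
      (hasCompactSupport_pd j (hwc j))
  have hdiv : ∫ x, ∑ j, pd j (fun y => u y ^ 2 * (y j * (‖y‖ ^ 2 + ε)⁻¹)) x = 0 := by
    rw [integral_finsetSum _ fun j _ => hwi j]
    exact Finset.sum_eq_zero fun j _ =>
      integral_pd_eq_zero j ((hw j).of_le (by exact_mod_cast le_top)) (hwc j)
  have hi1 : Integrable (fun x => u x ^ 2 * (‖x‖ ^ 2 + ε)⁻¹) :=
    ((hu.pow 2).mul hinv).continuous.integrable_of_hasCompactSupport hu2.mul_right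
  have hi2 : Integrable (fun x => ∑ j, pd j u x ^ 2) := by
    refine integrable_finsetSum _ fun j _ => ?_
    exact ((contDiff_pd j hu).pow 2).continuous.integrable_of_hasCompactSupport
      ((hasCompactSupport_pd j hc).comp_left (g := fun t : ℝ => t ^ 2) (by simp))
  have hi3 : Integrable (fun x => ∑ j, pd j (fun y => u y ^ 2 * (y j * (‖y‖ ^ 2 + ε)⁻¹)) x) :=
    integrable_finsetSum _ fun j _ => hwi j
  have hle : ∫ x, (1 / 2) * (u x ^ 2 * (‖x‖ ^ 2 + ε)⁻¹) ≤
      ∫ x, (2 * (∑ j, pd j u x ^ 2)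
        + ∑ j, pd j (fun y => u y ^ 2 * (y j * (‖y‖ ^ 2 + ε)⁻¹)) x) := by
    refine integral_mono (hi1.const_mul _) ((hi2.const_mul _).add hi3) fun x => ?_
    simp only [pd_hardyField _ (hu.differentiable (by simp)) hε, Fin.sum_univ_three]
    have hr := norm_sq_eq_sum x
    rw [Fin.sum_univ_three] at hr
    set φ := (‖x‖ ^ 2 + ε)⁻¹ with hφ
    have hφ0 : 0 < φ := by positivity
    have hφr : ‖x‖ ^ 2 * φ = 1 - ε * φ := by
      rw [hφ]; field_simp; ring
    have hφ2 : (x 0 ^ 2 + x 1 ^ 2 + x 2 ^ 2) * φ ^ 2 = φ - ε * φ ^ 2 := by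
      rw [← hr]; linear_combination φ * hφr
    have s0 := sq_nonneg (2 * pd 0 u x + u x * (x 0 * φ))
    have s1 := sq_nonneg (2 * pd 1 u x + u x * (x 1 * φ))
    have s2 := sq_nonneg (2 * pd 2 u x + u x * (x 2 * φ))
    have h6 : 0 ≤ u x ^ 2 * (ε * φ ^ 2) := by positivity
    have h7 : u x ^ 2 * ((x 0 ^ 2 + x 1 ^ 2 + x 2 ^ 2) * φ ^ 2) =
      u x ^ 2 * (φ - ε * φ ^ 2) := by rw [hφ2]
    nlinarith
  rw [integral_add (hi2.const_mul _) hi3, hdiv, integral_const_mul, integral_const_mul] at hle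
  linarith

/-- **Hardy's inequality** on `ℝ³`. -/
lemma hardy {u : Eu 3 → ℝ} (hu : ContDiff ℝ (⊤ : ℕ∞) u) (hc : HasCompactSupport u) :
    Integrable (fun x => u x ^ 2 * (‖x‖ ^ 2)⁻¹) ∧
      ∫ x, u x ^ 2 * (‖x‖ ^ 2)⁻¹ ≤ 4 * ∫ x, ∑ j, pd j u x ^ 2 := by
  set e : ℕ → ℝ := fun n => 1 / ((n : ℝ) + 1)
  have he : ∀ n, 0 < e n := fun n => by positivity
  have hmeas : ∀ t : ℝ, AEStronglyMeasurable (fun x => u x ^ 2 * (‖x‖ ^ 2 + t)⁻¹)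
      (volume : Measure (Eu 3)) := fun t =>
    ((hu.continuous.measurable.pow_const 2).mul
      ((measurable_norm.pow_const 2).add_const t).inv).aestronglyMeasurable
  have hne : ∀ᵐ x : Eu 3, x ≠ 0 := by simp [ae_iff]
  have hlim : ∀ᵐ x : Eu 3, Filter.Tendsto (fun n => u x ^ 2 * (‖x‖ ^ 2 + e n)⁻¹) Filter.atTop
      (nhds (u x ^ 2 * (‖x‖ ^ 2)⁻¹)) := by
    filter_upwards [hne] with x hx
    refine Filter.Tendsto.const_mul _ (Filter.Tendsto.inv₀ ?_ (by simpa using hx))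
    simpa [e] using (tendsto_one_div_add_atTop_nhds_zero_nat (𝕜 := ℝ)).const_add (‖x‖ ^ 2)
  have hint_n : ∀ n, Integrable (fun x => u x ^ 2 * (‖x‖ ^ 2 + e n)⁻¹) := fun n => by
    refine Continuous.integrable_of_hasCompactSupport ?_
      (hc.comp_left (g := fun t : ℝ => t ^ 2) (by simp)).mul_right
    refine (hu.continuous.pow 2).mul (Continuous.inv₀ (by fun_prop) fun x => ?_)
    have := he n
    positivity
  have hint : Integrable (fun x => u x ^ 2 * (‖x‖ ^ 2)⁻¹) := by
    refine ⟨aestronglyMeasurable_of_tendsto_ae _ (fun n => hmeas (e n)) hlim, ?_⟩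
    refine lt_of_le_of_lt ?_ (ENNReal.ofReal_lt_top (r := 4 * ∫ x, ∑ j, pd j u x ^ 2))
    refine le_trans (le_of_eq (lintegral_congr_ae (hlim.mono fun x hx => hx.enorm.liminf_eq.symm)))
      ((lintegral_liminf_le' fun n => (hmeas (e n)).enorm).trans ?_)
    refine Filter.liminf_le_of_frequently_le' (Filter.Frequently.of_forall fun n => ?_)
    rw [← ofReal_integral_norm_eq_lintegral_enorm (hint_n n)]
    refine ENNReal.ofReal_le_ofReal ?_
    refine le_trans (le_of_eq (integral_congr_ae (.of_forall fun x => ?_))) (hardy_reg hu hc (he n))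
    have := he n
    simp only [Real.norm_eq_abs]
    exact abs_of_nonneg (by positivity)
  refine ⟨hint, ?_⟩
  refine le_of_tendsto (tendsto_integral_of_dominated_convergence
    (fun x => u x ^ 2 * (‖x‖ ^ 2)⁻¹) (fun n => hmeas (e n)) hint (fun n => ?_) hlim)
    (.of_forall fun n => hardy_reg hu hc (he n))
  filter_upwards [hne] with x hx
  have := he n
  have hx' : 0 < ‖x‖ := norm_pos_iff.2 hx
  rw [Real.norm_eq_abs, abs_of_nonneg (by positivity)]
  gcongr
  linarith

lemma contDiff_det {n : ℕ} {h : Eu n → Matrix (Fin n) (Fin n) ℝ}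
    (hh : ∀ j k, ContDiff ℝ (⊤ : ℕ∞) fun x => h x j k) :
    ContDiff ℝ (⊤ : ℕ∞) fun x => (h x).det := by
  simp only [Matrix.det_apply]
  exact ContDiff.sum fun σ _ => (contDiff_prod fun i _ => hh _ _).const_smul _

lemma contDiff_inv_entry {n : ℕ} {h : Eu n → Matrix (Fin n) (Fin n) ℝ}
    (hh : ∀ j k, ContDiff ℝ (⊤ : ℕ∞) fun x => h x j k) (hp : ∀ x, (h x).PosDef) (j k : Fin n) :
    ContDiff ℝ (⊤ : ℕ∞) fun x => (h x)⁻¹ j k := by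
  simp only [Matrix.inv_def, Matrix.smul_apply, smul_eq_mul, Ring.inverse_eq_inv',
    Matrix.adjugate_apply]
  refine ((contDiff_det hh).inv fun x => (hp x).det_pos.ne').mul (contDiff_det fun a b => ?_)
  by_cases hak : a = k
  · subst hak
    simpa using contDiff_const
  · simpa [Matrix.updateRow_ne hak] using hh a b

lemma contDiff_sdet {n : ℕ} {h : Eu n → Matrix (Fin n) (Fin n) ℝ}
    (hh : ∀ j k, ContDiff ℝ (⊤ : ℕ∞) fun x => h x j k) (hp : ∀ x, (h x).PosDef) :
    ContDiff ℝ (⊤ : ℕ∞) (sdet h) :=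
  (contDiff_det hh).sqrt fun x => (hp x).det_pos.ne'

lemma contDiff_Chr {n : ℕ} {h : Eu n → Matrix (Fin n) (Fin n) ℝ}
    (hh : ∀ j k, ContDiff ℝ (⊤ : ℕ∞) fun x => h x j k) (hp : ∀ x, (h x).PosDef) (i j k : Fin n) :
    ContDiff ℝ (⊤ : ℕ∞) (Chr h i j k) := by
  unfold Chr
  exact contDiff_const.mul (ContDiff.sum fun l _ => (contDiff_inv_entry hh hp i l).mul
    (((contDiff_pd j (hh l k)).add (contDiff_pd k (hh j l))).sub (contDiff_pd l (hh j k))))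

lemma contDiff_Rscal {n : ℕ} {h : Eu n → Matrix (Fin n) (Fin n) ℝ}
    (hh : ∀ j k, ContDiff ℝ (⊤ : ℕ∞) fun x => h x j k) (hp : ∀ x, (h x).PosDef) :
    ContDiff ℝ (⊤ : ℕ∞) (Rscal h) := by
  have hC := contDiff_Chr hh hp
  unfold Rscal
  refine ContDiff.sum fun j _ => ContDiff.sum fun k _ => (contDiff_inv_entry hh hp j k).mul
    (ContDiff.sub (ContDiff.add (ContDiff.sub ?_ ?_) ?_) ?_)
  · exact ContDiff.sum fun i _ => contDiff_pd i (hC i j k)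
  · exact ContDiff.sum fun i _ => contDiff_pd k (hC i j i)
  · exact ContDiff.sum fun i _ => ContDiff.sum fun l _ => (hC l j k).mul (hC i i l)
  · exact ContDiff.sum fun i _ => ContDiff.sum fun l _ => (hC l j i).mul (hC i k l)

lemma det_mem_Icc {P : Matrix (Fin 3) (Fin 3) ℝ} (hP : P.PosDef) {ν N : ℝ} (hν : 0 < ν)
    (hb : ∀ ξ : Fin 3 → ℝ, ν * (∑ j, ξ j ^ 2) ≤ (∑ j, ∑ k, P j k * ξ j * ξ k) ∧
      (∑ j, ∑ k, P j k * ξ j * ξ k) ≤ N * (∑ j, ξ j ^ 2)) :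
    P.det ∈ Icc (ν ^ 3) (N ^ 3) := by
  have hH := hP.isHermitian
  have hev : ∀ i, hH.eigenvalues i ∈ Icc ν N := fun i => by
    have h1 := hH.eigenvalues_eq i
    have h2 := hb (hH.eigenvectorBasis i)
    have h3 : ∑ j, (hH.eigenvectorBasis i) j ^ 2 = 1 := by
      rw [← norm_sq_eq_sum, hH.eigenvectorBasis.orthonormal.1 i, one_pow]
    have h4 : hH.eigenvalues i = ∑ j, ∑ k, P j k * (hH.eigenvectorBasis i) j
        * (hH.eigenvectorBasis i) k := by
      rw [h1]
      simp only [dotProduct, Matrix.mulVec, Pi.star_apply, star_trivial, RCLike.re_to_real,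
        Finset.mul_sum]
      exact Finset.sum_congr rfl fun j _ => Finset.sum_congr rfl fun k _ => by ring
    rw [h3, ← h4] at h2
    simpa using h2
  rw [hH.det_eq_prod_eigenvalues]
  simp only [RCLike.ofReal_real_eq_id, id]
  constructor
  · simpa using Finset.prod_le_prod (s := Finset.univ) (f := fun _ : Fin 3 => ν)
      (fun _ _ => hν.le) fun i _ => (hev i).1
  · simpa using Finset.prod_le_prod (s := Finset.univ) (g := fun _ : Fin 3 => N)
      (fun i _ => hν.le.trans (hev i).1) fun i _ => (hev i).2

lemma sdet_mem_Icc {h : Eu 3 → Matrix (Fin 3) (Fin 3) ℝ} {ν N : ℝ} (hν : 0 < ν)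
    (hp : ∀ x, (h x).PosDef) (he : Elliptic h ν N) (x : Eu 3) :
    sdet h x ∈ Icc (√((N ^ 3)⁻¹)) (√((ν ^ 3)⁻¹)) := by
  have h1 := det_mem_Icc (hp x).inv hν (he x)
  have h2 : (h x).det = ((h x)⁻¹.det)⁻¹ := by
    rw [Matrix.det_nonsing_inv, Ring.inverse_eq_inv', inv_inv]
  have h3 : 0 < ν ^ 3 := by positivity
  unfold sdet
  rw [h2]
  exact ⟨Real.sqrt_le_sqrt (inv_anti₀ (h3.trans_le h1.1) h1.2),
    Real.sqrt_le_sqrt (inv_anti₀ h3 h1.1)⟩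

lemma pd_clm {n : ℕ} {F G : Type*} [NormedAddCommGroup F] [NormedSpace ℝ F]
    [NormedAddCommGroup G] [NormedSpace ℝ G] (L : F →L[ℝ] G) (j : Fin n) {f : Eu n → F}
    {x : Eu n} (hf : DifferentiableAt ℝ f x) :
    pd j (fun y => L (f y)) x = L (pd j f x) := by
  have h1 : fderiv ℝ (fun y => L (f y)) x = L.comp (fderiv ℝ f x) :=
    (L.hasFDerivAt.comp x hf.hasFDerivAt).fderiv
  simp [pd, h1]

lemma sq_norm_eq_re_sq_add_im_sq (z : ℂ) : ‖z‖ ^ 2 = z.re ^ 2 + z.im ^ 2 := by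
  rw [Complex.sq_norm, Complex.normSq_apply]
  ring

lemma hardy_complex {f : Eu 3 → ℂ} (hf : ContDiff ℝ (⊤ : ℕ∞) f) (hc : HasCompactSupport f) :
    Integrable (fun x => ‖f x‖ ^ 2 * (‖x‖ ^ 2)⁻¹) ∧
      ∫ x, ‖f x‖ ^ 2 * (‖x‖ ^ 2)⁻¹ ≤ 4 * ∫ x, ∑ j, ‖pd j f x‖ ^ 2 := by
  have hr := hardy (u := fun x => (f x).re) (Complex.reCLM.contDiff.comp hf)
    (hc.comp_left (g := Complex.re) (by simp))
  have hi := hardy (u := fun x => (f x).im) (Complex.imCLM.contDiff.comp hf)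
    (hc.comp_left (g := Complex.im) (by simp))
  have hint : ∀ L : ℂ →L[ℝ] ℝ, Integrable (fun x => ∑ j, pd j (fun y => L (f y)) x ^ 2) :=
    fun L => integrable_finsetSum _ fun j _ =>
      ((contDiff_pd j (L.contDiff.comp hf)).pow 2).continuous.integrable_of_hasCompactSupport
        ((hasCompactSupport_pd j (hc.comp_left (g := L) (by simp))).comp_left
          (g := fun t : ℝ => t ^ 2) (by simp))
  have hgrad : ∀ x, ∑ j, ‖pd j f x‖ ^ 2 = ∑ j, pd j (fun y => (f y).re) x ^ 2
      + ∑ j, pd j (fun y => (f y).im) x ^ 2 := fun x => by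
    have hd := hf.differentiable (by simp) x
    have h1 : ∀ j, pd j (fun y => (f y).re) x = (pd j f x).re :=
      fun j => pd_clm Complex.reCLM j hd
    have h2 : ∀ j, pd j (fun y => (f y).im) x = (pd j f x).im :=
      fun j => pd_clm Complex.imCLM j hd
    simp only [h1, h2, sq_norm_eq_re_sq_add_im_sq, Finset.sum_add_distrib]
  have hval : ∀ x, ‖f x‖ ^ 2 * (‖x‖ ^ 2)⁻¹ = (f x).re ^ 2 * (‖x‖ ^ 2)⁻¹
      + (f x).im ^ 2 * (‖x‖ ^ 2)⁻¹ := fun x => by rw [sq_norm_eq_re_sq_add_im_sq, add_mul]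
  simp only [hval, hgrad]
  refine ⟨hr.1.add hi.1, ?_⟩
  have hire : Integrable fun x => ∑ j, pd j (fun y => (f y).re) x ^ 2 := hint Complex.reCLM
  have hiim : Integrable fun x => ∑ j, pd j (fun y => (f y).im) x ^ 2 := hint Complex.imCLM
  rw [integral_add hire hiim, integral_add hr.1 hi.1, mul_add]
  exact add_le_add hr.2 hi.2

lemma contDiff_ofReal {n : ℕ} {s : Eu n → ℝ} (hs : ContDiff ℝ (⊤ : ℕ∞) s) :
    ContDiff ℝ (⊤ : ℕ∞) fun x => ((s x : ℝ) : ℂ) :=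
  Complex.ofRealCLM.contDiff.comp hs

/-- The flux `√(det h) h^{jk} ∂_k f` whose divergence is `√(det h) Δ_h f`. -/
def flux {n : ℕ} (h : Eu n → Matrix (Fin n) (Fin n) ℝ) (f : Eu n → ℂ) (j : Fin n) (y : Eu n) : ℂ :=
  ((sdet h y : ℝ) : ℂ) * ∑ k, (((h y)⁻¹ j k : ℝ) : ℂ) * pd k f y

lemma contDiff_flux {n : ℕ} {h : Eu n → Matrix (Fin n) (Fin n) ℝ}
    (hh : ∀ j k, ContDiff ℝ (⊤ : ℕ∞) fun x => h x j k) (hp : ∀ x, (h x).PosDef)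
    {f : Eu n → ℂ} (hf : ContDiff ℝ (⊤ : ℕ∞) f) (j : Fin n) :
    ContDiff ℝ (⊤ : ℕ∞) (flux h f j) :=
  (contDiff_ofReal (contDiff_sdet hh hp)).mul (ContDiff.sum fun k _ =>
    (contDiff_ofReal (contDiff_inv_entry hh hp j k)).mul (contDiff_pd k hf))

lemma sdet_pos {n : ℕ} {h : Eu n → Matrix (Fin n) (Fin n) ℝ} (hp : ∀ x, (h x).PosDef) (x : Eu n) :
    0 < sdet h x :=
  Real.sqrt_pos.2 (hp x).det_pos

lemma lapC_mul_sdet {n : ℕ} {h : Eu n → Matrix (Fin n) (Fin n) ℝ} (hp : ∀ x, (h x).PosDef)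
    (f : Eu n → ℂ) (x : Eu n) :
    lapC h f x * ((sdet h x : ℝ) : ℂ) = ∑ j, pd j (flux h f j) x := by
  have : ((sdet h x : ℝ) : ℂ) ≠ 0 := by exact_mod_cast (sdet_pos hp x).ne'
  rw [lapC, mul_comm, mul_inv_cancel_left₀ this]
  rfl

lemma continuous_lapC_mul_sdet {n : ℕ} {h : Eu n → Matrix (Fin n) (Fin n) ℝ}
    (hh : ∀ j k, ContDiff ℝ (⊤ : ℕ∞) fun x => h x j k) (hp : ∀ x, (h x).PosDef)
    {f : Eu n → ℂ} (hf : ContDiff ℝ (⊤ : ℕ∞) f) :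
    Continuous fun x => lapC h f x * ((sdet h x : ℝ) : ℂ) := by
  simp only [lapC_mul_sdet hp]
  exact continuous_finsetSum _ fun j _ => (contDiff_pd j (contDiff_flux hh hp hf j)).continuous

lemma integrable_conj_pd_mul_flux {n : ℕ} {h : Eu n → Matrix (Fin n) (Fin n) ℝ}
    (hh : ∀ j k, ContDiff ℝ (⊤ : ℕ∞) fun x => h x j k) (hp : ∀ x, (h x).PosDef)
    {f : Eu n → ℂ} (hf : ContDiff ℝ (⊤ : ℕ∞) f) (hc : HasCompactSupport f) :
    Integrable fun x => ∑ j, (starRingEnd ℂ) (pd j f x) * flux h f j x :=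
  integrable_finsetSum _ fun j _ =>
    ((Complex.continuous_conj.comp (contDiff_pd j hf).continuous).mul
      (contDiff_flux hh hp hf j).continuous).integrable_of_hasCompactSupport
      ((hasCompactSupport_pd j hc).comp_left (g := starRingEnd ℂ) (by simp)).mul_right

/-- Green's identity for the Laplace–Beltrami operator. -/
lemma integral_conj_mul_lapC {n : ℕ} {h : Eu n → Matrix (Fin n) (Fin n) ℝ}
    (hh : ∀ j k, ContDiff ℝ (⊤ : ℕ∞) fun x => h x j k) (hp : ∀ x, (h x).PosDef)
    {f : Eu n → ℂ} (hf : ContDiff ℝ (⊤ : ℕ∞) f) (hc : HasCompactSupport f) :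
    ∫ x, (starRingEnd ℂ) (f x) * (lapC h f x * ((sdet h x : ℝ) : ℂ))
      = -∫ x, ∑ j, (starRingEnd ℂ) (pd j f x) * flux h f j x := by
  have hfc : ContDiff ℝ (⊤ : ℕ∞) fun x => (starRingEnd ℂ) (f x) :=
    Complex.conjCLE.contDiff.comp hf
  have hcc : HasCompactSupport fun x => (starRingEnd ℂ) (f x) :=
    hc.comp_left (g := starRingEnd ℂ) (by simp)
  have hF := contDiff_flux hh hp hf
  have hpd : ∀ j x, pd j (fun y => (starRingEnd ℂ) (f y) * flux h f j y) x
      = (starRingEnd ℂ) (pd j f x) * flux h f j x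
        + (starRingEnd ℂ) (f x) * pd j (flux h f j) x := fun j x => by
    rw [pd_mul j (hfc.differentiable (by simp) x) ((hF j).differentiable (by simp) x)]
    congr 2
    exact pd_clm (Complex.conjCLE : ℂ →L[ℝ] ℂ) j (hf.differentiable (by simp) x)
  have hi : ∀ j, Integrable (pd j (fun y => (starRingEnd ℂ) (f y) * flux h f j y)) := fun j =>
    (contDiff_pd j (hfc.mul (hF j))).continuous.integrable_of_hasCompactSupport
      (hasCompactSupport_pd j hcc.mul_right)
  have h0 : ∫ x, ∑ j, pd j (fun y => (starRingEnd ℂ) (f y) * flux h f j y) x = 0 := by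
    rw [integral_finsetSum _ fun j _ => hi j]
    exact Finset.sum_eq_zero fun j _ => integral_pd_eq_zero j
      ((hfc.mul (hF j)).of_le (by exact_mod_cast le_top)) hcc.mul_right
  have h1 : ∀ x, (starRingEnd ℂ) (f x) * (lapC h f x * ((sdet h x : ℝ) : ℂ))
      = ∑ j, pd j (fun y => (starRingEnd ℂ) (f y) * flux h f j y) x
        - ∑ j, (starRingEnd ℂ) (pd j f x) * flux h f j x := fun x => by
    simp only [lapC_mul_sdet hp, hpd, Finset.mul_sum, Finset.sum_add_distrib]
    ring
  simp only [h1]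
  rw [integral_sub (integrable_finsetSum _ fun j _ => hi j)
    (integrable_conj_pd_mul_flux hh hp hf hc), h0, zero_sub]

lemma le_re_sum_conj_mul_flux {h : Eu 3 → Matrix (Fin 3) (Fin 3) ℝ} {ν N : ℝ}
    (he : Elliptic h ν N) (f : Eu 3 → ℂ) (x : Eu 3) :
    sdet h x * (ν * ∑ j, ‖pd j f x‖ ^ 2)
      ≤ (∑ j, (starRingEnd ℂ) (pd j f x) * flux h f j x).re := by
  have h1 := (he x fun j => (pd j f x).re).1
  have h2 := (he x fun j => (pd j f x).im).1
  have hs : 0 ≤ sdet h x := Real.sqrt_nonneg _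
  have h3 : (∑ j, (starRingEnd ℂ) (pd j f x) * flux h f j x).re = sdet h x *
      ((∑ j, ∑ k, (h x)⁻¹ j k * (pd j f x).re * (pd k f x).re)
        + ∑ j, ∑ k, (h x)⁻¹ j k * (pd j f x).im * (pd k f x).im) := by
    simp [flux, Fin.sum_univ_three]
    ring
  rw [h3]
  refine mul_le_mul_of_nonneg_left ?_ hs
  refine le_trans (le_of_eq ?_) (add_le_add h1 h2)
  simp only [sq_norm_eq_re_sq_add_im_sq, ← mul_add, ← Finset.sum_add_distrib]

lemma integrable_hardy_density {h : Eu 3 → Matrix (Fin 3) (Fin 3) ℝ}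
    (hh : ∀ j k, ContDiff ℝ (⊤ : ℕ∞) fun x => h x j k) (hp : ∀ x, (h x).PosDef) {b : ℝ}
    (hb : ∀ x, sdet h x ≤ b) {f : Eu 3 → ℂ} (hf : ContDiff ℝ (⊤ : ℕ∞) f)
    (hc : HasCompactSupport f) :
    Integrable fun x => ‖f x‖ ^ 2 * (‖x‖ ^ 2)⁻¹ * sdet h x := by
  refine (hardy_complex hf hc).1.mul_bdd (c := b)
    (contDiff_sdet hh hp).continuous.aestronglyMeasurable (.of_forall fun x => ?_)
  rw [Real.norm_eq_abs, abs_of_pos (sdet_pos hp x)]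
  exact hb x

lemma hardy_energy {h : Eu 3 → Matrix (Fin 3) (Fin 3) ℝ}
    (hh : ∀ j k, ContDiff ℝ (⊤ : ℕ∞) fun x => h x j k) (hp : ∀ x, (h x).PosDef) {ν N a b : ℝ}
    (hν : 0 < ν) (he : Elliptic h ν N) (ha : 0 < a) (hab : ∀ x, sdet h x ∈ Icc a b)
    {f : Eu 3 → ℂ} (hf : ContDiff ℝ (⊤ : ℕ∞) f) (hc : HasCompactSupport f) :
    ν * a / (4 * b) * ∫ x, ‖f x‖ ^ 2 * (‖x‖ ^ 2)⁻¹ * sdet h x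
      ≤ (-∫ x, (starRingEnd ℂ) (f x) * (lapC h f x * ((sdet h x : ℝ) : ℂ))).re := by
  have hb : 0 < b := ha.trans_le ((hab 0).1.trans (hab 0).2)
  obtain ⟨hH1, hH2⟩ := hardy_complex hf hc
  have hI1 := integrable_hardy_density hh hp (fun x => (hab x).2) hf hc
  have hI2 := integrable_conj_pd_mul_flux hh hp hf hc
  have hI2re : Integrable fun x => (∑ j, (starRingEnd ℂ) (pd j f x) * flux h f j x).re :=
    hI2.re
  have hI3 : Integrable fun x => ∑ j, ‖pd j f x‖ ^ 2 := by
    refine integrable_finsetSum _ fun j _ => ?_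
    have hcont : Continuous fun x => ‖pd j f x‖ ^ 2 := (contDiff_pd j hf).continuous.norm.pow 2
    have hsupp : HasCompactSupport fun x => ‖pd j f x‖ ^ 2 :=
      (hasCompactSupport_pd j hc).comp_left (g := fun z : ℂ => ‖z‖ ^ 2) (by simp)
    exact hcont.integrable_of_hasCompactSupport hsupp
  rw [integral_conj_mul_lapC hh hp hf hc, neg_neg]
  have hre : (∫ x, ∑ j, (starRingEnd ℂ) (pd j f x) * flux h f j x).re
      = ∫ x, (∑ j, (starRingEnd ℂ) (pd j f x) * flux h f j x).re := 
    (Complex.reCLM.integral_comp_comm hI2).symm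
  rw [hre]
  have s1 : ∫ x, ‖f x‖ ^ 2 * (‖x‖ ^ 2)⁻¹ * sdet h x ≤ b * ∫ x, ‖f x‖ ^ 2 * (‖x‖ ^ 2)⁻¹ := by
    rw [← integral_const_mul]
    refine integral_mono hI1 (hH1.const_mul b) fun x => ?_
    have := (hab x).2
    simp only [mul_comm b]
    gcongr
  have s2 : a * ν * ∫ x, ∑ j, ‖pd j f x‖ ^ 2
      ≤ ∫ x, (∑ j, (starRingEnd ℂ) (pd j f x) * flux h f j x).re := by
    rw [← integral_const_mul]
    refine integral_mono (hI3.const_mul _) hI2re fun x => ?_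
    refine le_trans ?_ (le_re_sum_conj_mul_flux he f x)
    have := (hab x).1
    simp only [mul_assoc]
    gcongr
  refine le_trans ?_ s2
  calc ν * a / (4 * b) * ∫ x, ‖f x‖ ^ 2 * (‖x‖ ^ 2)⁻¹ * sdet h x
      ≤ ν * a / (4 * b) * (b * (4 * ∫ x, ∑ j, ‖pd j f x‖ ^ 2)) := by
        gcongr
        exact s1.trans (by gcongr)
    _ = a * ν * ∫ x, ∑ j, ‖pd j f x‖ ^ 2 := by
        field_simp

lemma contDiff_Hop {A : Fin 3 → Eu 3 → Fin 4 → Fin 4 → ℂ} {B : Eu 3 → Fin 4 → Fin 4 → ℂ}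
    (hA : ∀ j i k, ContDiff ℝ (⊤ : ℕ∞) fun x => A j x i k)
    (hB : ∀ i k, ContDiff ℝ (⊤ : ℕ∞) fun x => B x i k)
    {f : Eu 3 → Fin 4 → ℂ} (hf : ContDiff ℝ (⊤ : ℕ∞) f) : ContDiff ℝ (⊤ : ℕ∞) (Hop A B f) := by
  refine contDiff_pi.2 fun i => ContDiff.add ?_ ?_
  · exact ContDiff.sum fun j _ => ContDiff.sum fun k _ =>
      (hA j i k).mul (contDiff_pi.1 (contDiff_pd j hf) k)
  · exact ContDiff.sum fun k _ => (hB i k).mul (contDiff_pi.1 hf k)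

lemma hasCompactSupport_Hop (A : Fin 3 → Eu 3 → Fin 4 → Fin 4 → ℂ)
    (B : Eu 3 → Fin 4 → Fin 4 → ℂ) {f : Eu 3 → Fin 4 → ℂ} (hc : HasCompactSupport f) :
    HasCompactSupport (Hop A B f) := by
  refine HasCompactSupport.intro hc fun x hx => ?_
  have h0 : f x = 0 := image_eq_zero_of_notMem_tsupport hx
  have h1 : ∀ j, pd j f x = 0 := fun j => by
    simp [pd, fderiv_of_notMem_tsupport ℝ hx]
  funext i
  simp [Hop, h0, h1]

lemma innC4_self (h : Eu 3 → Matrix (Fin 3) (Fin 3) ℝ) (g : Eu 3 → Fin 4 → ℂ) :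
    (innC4 h g g).re = ∫ x, (∑ i, ‖g x i‖ ^ 2) * sdet h x := by
  have : innC4 h g g = ((∫ x, (∑ i, ‖g x i‖ ^ 2) * sdet h x : ℝ) : ℂ) := by
    rw [innC4, ← integral_complex_ofReal]
    simp [Complex.conj_mul']
  rw [this, Complex.ofReal_re]

/-- **Hardy-type estimate** for the Dirac-type operator `H` with `H² = m² − Δ_h + ¼R_h`. -/
theorem stmt5 (ν N : ℝ) (hν : 0 < ν) (hνN : ν ≤ N) :
    ∃ c > (0 : ℝ),
      ∀ h : Eu 3 → Matrix (Fin 3) (Fin 3) ℝ,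
        (∀ j k : Fin 3, ContDiff ℝ (⊤ : ℕ∞) fun x => h x j k) →
        (∀ x, (h x).IsSymm) → (∀ x, (h x).PosDef) →
        Elliptic h ν N →
        ∀ σ' CR : ℝ, σ' ∈ Set.Ioo (0 : ℝ) 1 → 0 ≤ CR →
          (∀ x : Eu 3, x ≠ 0 → |Rscal h x| ≤ CR * jap x ^ (-(1 + σ')) * ‖x‖⁻¹) →
          CR < c →
          ∀ m : ℝ, 0 ≤ m →
            ∀ (A : Fin 3 → Eu 3 → Fin 4 → Fin 4 → ℂ) (B : Eu 3 → Fin 4 → Fin 4 → ℂ),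
              (∀ j i k, ContDiff ℝ (⊤ : ℕ∞) fun x => A j x i k) →
              (∀ i k, ContDiff ℝ (⊤ : ℕ∞) fun x => B x i k) →
              (∀ f g : Eu 3 → Fin 4 → ℂ, ContDiff ℝ (⊤ : ℕ∞) f → ContDiff ℝ (⊤ : ℕ∞) g →
                HasCompactSupport f → HasCompactSupport g →
                innC4 h (Hop A B f) g = innC4 h f (Hop A B g)) →
              (∀ f : Eu 3 → Fin 4 → ℂ, ContDiff ℝ (⊤ : ℕ∞) f → ∀ (x : Eu 3) (i : Fin 4),
                Hop A B (Hop A B f) x i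
                  = ((m : ℂ) ^ 2) * f x i - lapC h (fun y => f y i) x
                    + ((Rscal h x / 4 : ℝ) : ℂ) * f x i) →
              ∀ f : Eu 3 → Fin 4 → ℂ, ContDiff ℝ (⊤ : ℕ∞) f → HasCompactSupport f →
                m ^ 2 * (∫ x : Eu 3, (∑ i, ‖f x i‖ ^ 2) * sdet h x)
                    + (c - CR) * ∫ x : Eu 3, (∑ i, ‖f x i‖ ^ 2) * (‖x‖ ^ 2)⁻¹ * sdet h x
                  ≤ ∫ x : Eu 3, (∑ i, ‖Hop A B f x i‖ ^ 2) * sdet h x := by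
  have hN : 0 < N := hν.trans_le hνN
  set a := √((N ^ 3)⁻¹)
  set b := √((ν ^ 3)⁻¹)
  have ha : 0 < a := Real.sqrt_pos.2 (by positivity)
  have hb : 0 < b := Real.sqrt_pos.2 (by positivity)
  refine ⟨ν * a / (4 * b), by positivity, ?_⟩
  intro h hh _ hp he σ' CR hσ hCR hR _ m _ A B hA hB hsymm hsq f hf hc
  set c := ν * a / (4 * b)
  have hab : ∀ x, sdet h x ∈ Icc a b := sdet_mem_Icc hν hp he
  have hfi : ∀ i, ContDiff ℝ (⊤ : ℕ∞) fun x => f x i := contDiff_pi.1 hf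
  have hci : ∀ i, HasCompactSupport fun x => f x i := fun i =>
    hc.comp_left (g := fun v : Fin 4 → ℂ => v i) rfl
  have hsc := (contDiff_sdet hh hp).continuous
  have hS : Continuous fun x => ∑ i, ‖f x i‖ ^ 2 :=
    continuous_finsetSum _ fun i _ => (hfi i).continuous.norm.pow 2
  have hSc : HasCompactSupport fun x => ∑ i, ‖f x i‖ ^ 2 :=
    hc.comp_left (g := fun v : Fin 4 → ℂ => ∑ i, ‖v i‖ ^ 2) (by simp)
  have hIS : Integrable fun x => (∑ i, ‖f x i‖ ^ 2) * sdet h x :=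
    (hS.mul hsc).integrable_of_hasCompactSupport hSc.mul_right
  have hIR : Integrable fun x => (∑ i, ‖f x i‖ ^ 2) * (Rscal h x / 4 * sdet h x) :=
    (hS.mul (((contDiff_Rscal hh hp).continuous.div_const 4).mul
      hsc)).integrable_of_hasCompactSupport hSc.mul_right
  have hIL : ∀ i, Integrable fun x => (starRingEnd ℂ) (f x i)
      * (lapC h (fun y => f y i) x * ((sdet h x : ℝ) : ℂ)) := fun i =>
    ((Complex.continuous_conj.comp (hfi i).continuous).mul
      (continuous_lapC_mul_sdet hh hp (hfi i))).integrable_of_hasCompactSupport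
      ((hci i).comp_left (g := starRingEnd ℂ) (by simp)).mul_right
  have hIJ : ∀ i, Integrable fun x => ‖f x i‖ ^ 2 * (‖x‖ ^ 2)⁻¹ * sdet h x := fun i =>
    integrable_hardy_density hh hp (fun x => (hab x).2) (hfi i) (hci i)
  have hJ : ∀ x, (∑ i, ‖f x i‖ ^ 2) * (‖x‖ ^ 2)⁻¹ * sdet h x
      = ∑ i, ‖f x i‖ ^ 2 * (‖x‖ ^ 2)⁻¹ * sdet h x := fun x => by
    simp only [Finset.sum_mul]
  have hIJs : Integrable fun x => (∑ i, ‖f x i‖ ^ 2) * (‖x‖ ^ 2)⁻¹ * sdet h x := by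
    simp only [hJ]
    exact integrable_finsetSum _ fun i _ => hIJ i
  have hexp : innC4 h f (Hop A B (Hop A B f))
      = ((m ^ 2 * ∫ x, (∑ i, ‖f x i‖ ^ 2) * sdet h x : ℝ) : ℂ)
        + ∑ i, (-∫ x, (starRingEnd ℂ) (f x i)
          * (lapC h (fun y => f y i) x * ((sdet h x : ℝ) : ℂ)))
        + ((∫ x, (∑ i, ‖f x i‖ ^ 2) * (Rscal h x / 4 * sdet h x) : ℝ) : ℂ) := by
    have hIm : Integrable fun x => ((m ^ 2 * ((∑ i, ‖f x i‖ ^ 2) * sdet h x) : ℝ) : ℂ) :=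
      (hIS.const_mul (m ^ 2)).ofReal
    have hILs := integrable_finsetSum Finset.univ fun i _ => hIL i
    have hIs : Integrable fun x => ((m ^ 2 * ((∑ i, ‖f x i‖ ^ 2) * sdet h x) : ℝ) : ℂ)
        - ∑ i, (starRingEnd ℂ) (f x i)
          * (lapC h (fun y => f y i) x * ((sdet h x : ℝ) : ℂ)) := hIm.sub hILs
    have hIRc : Integrable fun x =>
        (((∑ i, ‖f x i‖ ^ 2) * (Rscal h x / 4 * sdet h x) : ℝ) : ℂ) := hIR.ofReal
    rw [← integral_const_mul, ← integral_complex_ofReal, ← integral_complex_ofReal,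
      Finset.sum_neg_distrib, ← integral_finsetSum _ fun i _ => hIL i, ← sub_eq_add_neg,
      ← integral_sub hIm hILs, ← integral_add hIs hIRc, innC4]
    refine integral_congr_ae (.of_forall fun x => ?_)
    simp only [hsq f hf, Complex.ofReal_mul, Complex.ofReal_add, Complex.ofReal_pow,
      ← Complex.conj_mul', Fin.sum_univ_four]
    ring
  have hcurv : -(CR * ∫ x, (∑ i, ‖f x i‖ ^ 2) * (‖x‖ ^ 2)⁻¹ * sdet h x)
      ≤ ∫ x, (∑ i, ‖f x i‖ ^ 2) * (Rscal h x / 4 * sdet h x) := by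
    rw [← integral_const_mul, ← integral_neg]
    refine integral_mono_ae (hIJs.const_mul _).neg hIR ?_
    have hne : ∀ᵐ x : Eu 3, x ≠ 0 := by simp [ae_iff]
    filter_upwards [hne] with x hx
    have hx' : 0 < ‖x‖ := norm_pos_iff.2 hx
    have hjap : jap x ^ (-(1 + σ')) ≤ ‖x‖⁻¹ := by
      have h1 : 1 ≤ jap x := Real.one_le_sqrt.2 (by nlinarith)
      have h2 : ‖x‖ ≤ jap x := Real.le_sqrt_of_sq_le (by linarith)
      calc jap x ^ (-(1 + σ')) ≤ jap x ^ (-1 : ℝ) :=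
            Real.rpow_le_rpow_of_exponent_le h1 (by linarith [hσ.1])
        _ = (jap x)⁻¹ := Real.rpow_neg_one _
        _ ≤ ‖x‖⁻¹ := inv_anti₀ hx' h2
    have hRx : |Rscal h x| ≤ CR * (‖x‖ ^ 2)⁻¹ := by
      refine (hR x hx).trans ?_
      rw [pow_two, mul_inv, ← mul_assoc]
      gcongr
    have h3 : -(CR * (‖x‖ ^ 2)⁻¹) ≤ Rscal h x / 4 := by
      have := (abs_le.1 hRx).1
      have : 0 ≤ CR * (‖x‖ ^ 2)⁻¹ := by positivity
      linarith
    have h4 : 0 ≤ (∑ i, ‖f x i‖ ^ 2) * sdet h x :=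
      mul_nonneg (by positivity) (sdet_pos hp x).le
    have := mul_le_mul_of_nonneg_left h3 h4
    linarith
  have henergy : c * ∫ x, (∑ i, ‖f x i‖ ^ 2) * (‖x‖ ^ 2)⁻¹ * sdet h x
      ≤ (∑ i, (-∫ x, (starRingEnd ℂ) (f x i)
          * (lapC h (fun y => f y i) x * ((sdet h x : ℝ) : ℂ)))).re := by
    simp only [hJ]
    rw [integral_finsetSum _ fun i _ => hIJ i, Finset.mul_sum, Complex.re_sum]
    exact Finset.sum_le_sum fun i _ => hardy_energy hh hp hν he ha hab (hfi i) (hci i)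
  have hmain := hsymm f (Hop A B f) hf (contDiff_Hop hA hB hf) hc (hasCompactSupport_Hop A B hc)
  rw [← innC4_self h (Hop A B f), hmain, hexp, Complex.add_re, Complex.add_re, Complex.ofReal_re,
    Complex.ofReal_re]
  linarith
end
end

section
/- Suppose h satisfies the uniform ellipticity bounds with constants ν, N. There is a constant C = C(ν,N) > 0, depending only on ν and N, such that for every compactly supported smooth u:ℝ³→ℂ one has ‖u‖²_X ≤ C ( sup_{R>1} R^{-2} ∫_{S_R} |u|² √(det h) dS + ‖∇u‖²_Y ), where ∇u is the Euclidean gradient. -/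
noncomputable section
open MeasureTheory Real Set

/-- Campanato-type norm `‖·‖²_X` applied to the pointwise square `f`:
`sup_{R>0} ⟨R⟩⁻² ∫_{S_R} f √det h dS`. -/
def Xsq (h : Eu 3 → Matrix (Fin 3) (Fin 3) ℝ) (f : Eu 3 → ℝ) : ℝ :=
  ⨆ R : ℝ, ⨆ _ : 0 < R, (1 + R ^ 2)⁻¹ * sphInt (fun x => f x * sdet h x) R

/-- Campanato-type norm `‖·‖²_Y` applied to the pointwise square `f`:
`sup_{R>0} ⟨R⟩⁻¹ ∫_{B_R} f √det h dx`. -/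
def Ysq (h : Eu 3 → Matrix (Fin 3) (Fin 3) ℝ) (f : Eu 3 → ℝ) : ℝ :=
  ⨆ R : ℝ, ⨆ _ : 0 < R,
    (Real.sqrt (1 + R ^ 2))⁻¹ * ∫ x in Metric.ball (0 : Eu 3) R, f x * sdet h x

/-- Polar coordinates: the integral over a finite-dimensional normed space as an iterated integral
over the unit sphere and the radius. -/
theorem integral_eq_integral_toSphere_Ioi {E : Type*} [NormedAddCommGroup E] [NormedSpace ℝ E]
    [MeasurableSpace E] [BorelSpace E] [FiniteDimensional ℝ E] [Nontrivial E]
    (μ : Measure E) [μ.IsAddHaarMeasure] {g : E → ℝ} (hg : Integrable g μ) :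
    ∫ x, g x ∂μ = ∫ ω : Metric.sphere (0 : E) 1, (∫ r in Ioi (0 : ℝ),
      r ^ (Module.finrank ℝ E - 1) * g (r • (ω : E))) ∂μ.toSphere := by
  have hmp := μ.measurePreserving_homeomorphUnitSphereProd
  have hemb := (homeomorphUnitSphereProd E).measurableEmbedding
  set G : Metric.sphere (0 : E) 1 × Ioi (0 : ℝ) → ℝ := fun p => g (p.2.1 • p.1.1) with hG
  have hcomp : ∀ x : ({0}ᶜ : Set E), G (homeomorphUnitSphereProd E x) = g x := by
    intro x
    have hx : ‖(x : E)‖ ≠ 0 := norm_ne_zero_iff.2 x.2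
    simp [hG, smul_smul, hx]
  have hint : Integrable G (μ.toSphere.prod (.volumeIoiPow (Module.finrank ℝ E - 1))) := by
    rw [← hmp.integrable_comp_emb hemb]
    have h1 : G ∘ homeomorphUnitSphereProd E = fun x : ({0}ᶜ : Set E) => g x := funext hcomp
    rw [h1]
    exact (integrableOn_iff_comap_subtypeVal (measurableSet_singleton (0 : E)).compl).1
      hg.integrableOn
  calc ∫ x, g x ∂μ = ∫ x : ({(0)}ᶜ : Set E), g x.1 ∂(μ.comap (↑)) := by
        rw [integral_subtype_comap (measurableSet_singleton _).compl, restrict_compl_singleton]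
    _ = ∫ p, G p ∂μ.toSphere.prod (.volumeIoiPow (Module.finrank ℝ E - 1)) := by
        rw [← hmp.integral_comp hemb]
        exact integral_congr_ae (.of_forall fun x => (hcomp x).symm)
    _ = ∫ ω, ∫ r, G (ω, r) ∂(.volumeIoiPow (Module.finrank ℝ E - 1)) ∂μ.toSphere :=
        integral_prod _ hint
    _ = _ := by
        refine integral_congr_ae (.of_forall fun ω => ?_)
        simp only [Measure.volumeIoiPow, ENNReal.ofReal, hG]
        rw [integral_withDensity_eq_integral_smul,
          integral_subtype_comap measurableSet_Ioi fun a : ℝ =>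
            Real.toNNReal (a ^ (Module.finrank ℝ E - 1)) • g (a • (ω : E)),
          setIntegral_congr_fun measurableSet_Ioi fun x hx => ?_]
        · rw [NNReal.smul_def, Real.coe_toNNReal _ (pow_nonneg (le_of_lt hx) _), smul_eq_mul]
        · exact (measurable_subtype_coe.pow_const _).real_toNNReal

theorem setIntegral_ball_eq_integral_toSphere {F : Eu 3 → ℝ} (hF : Continuous F) {a : ℝ}
    (ha : 0 ≤ a) :
    ∫ x in Metric.ball (0 : Eu 3) a, F x =
      ∫ ω : Metric.sphere (0 : Eu 3) 1,
        (∫ r in (0 : ℝ)..a, r ^ 2 * F (r • (ω : Eu 3))) ∂(volume.toSphere) := by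
  have hint : IntegrableOn F (Metric.ball (0 : Eu 3) a) :=
    (hF.continuousOn.integrableOn_compact (isCompact_closedBall (0 : Eu 3) a)).mono_set
      Metric.ball_subset_closedBall
  rw [← integral_indicator measurableSet_ball,
    integral_eq_integral_toSphere_Ioi _ (hint.integrable_indicator measurableSet_ball)]
  refine integral_congr_ae (.of_forall fun ω => ?_)
  have hω : ‖(ω : Eu 3)‖ = 1 := by simp
  have hd : Module.finrank ℝ (Eu 3) - 1 = 2 := by simp
  simp only [hd]
  rw [intervalIntegral.integral_of_le ha, integral_Ioc_eq_integral_Ioo,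
    ← integral_indicator measurableSet_Ioi, ← integral_indicator measurableSet_Ioo]
  refine integral_congr_ae (.of_forall fun r => ?_)
  by_cases hr : 0 < r
  · have h1 : ‖r • (ω : Eu 3)‖ = r := by rw [norm_smul, hω, mul_one, norm_of_nonneg hr.le]
    by_cases hra : r < a <;> simp [indicator, hr, hra, h1]
  · simp [indicator, hr]

theorem det_bounds_of_quadratic_form_bounds {n : ℕ} {A : Matrix (Fin n) (Fin n) ℝ}
    (hA : A.IsHermitian) {ν N : ℝ} (hν : 0 ≤ ν)
    (hE : ∀ ξ : Fin n → ℝ, ν * (∑ j, ξ j ^ 2) ≤ (∑ j, ∑ k, A j k * ξ j * ξ k) ∧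
      (∑ j, ∑ k, A j k * ξ j * ξ k) ≤ N * (∑ j, ξ j ^ 2)) :
    ν ^ n ≤ A.det ∧ A.det ≤ N ^ n := by
  have key : ∀ i, ν ≤ hA.eigenvalues i ∧ hA.eigenvalues i ≤ N := by
    intro i
    have h1 : ∑ j, (hA.eigenvectorBasis i) j ^ 2 = 1 := by
      have h2 := EuclideanSpace.norm_sq_eq (hA.eigenvectorBasis i)
      rw [hA.eigenvectorBasis.norm_eq_one] at h2
      simpa using h2.symm
    have h3 : hA.eigenvalues i =
        ∑ j, ∑ k, A j k * (hA.eigenvectorBasis i) j * (hA.eigenvectorBasis i) k := by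
      rw [hA.eigenvalues_eq]
      simp only [dotProduct, Matrix.mulVec, Finset.mul_sum, RCLike.re_to_real, Pi.star_apply,
        star_trivial]
      exact Finset.sum_congr rfl fun j _ => Finset.sum_congr rfl fun k _ => by ring
    have h4 := hE (hA.eigenvectorBasis i)
    rw [h1, mul_one, mul_one, ← h3] at h4
    exact h4
  have hdet : A.det = ∏ i, hA.eigenvalues i := by simpa using hA.det_eq_prod_eigenvalues
  rw [hdet]
  constructor
  · simpa using Finset.prod_le_prod (s := Finset.univ) (fun i _ => hν) (fun i _ => (key i).1)
  · simpa using Finset.prod_le_prod (s := Finset.univ) (fun i _ => hν.trans (key i).1)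
      (fun i _ => (key i).2)

theorem sdet_bounds {h : Eu 3 → Matrix (Fin 3) (Fin 3) ℝ} {ν N : ℝ} (hν : 0 < ν)
    (hpos : ∀ x, (h x).PosDef) (hE : Elliptic h ν N) (x : Eu 3) :
    √((N ^ 3)⁻¹) ≤ sdet h x ∧ sdet h x ≤ √((ν ^ 3)⁻¹) := by
  have hd := det_bounds_of_quadratic_form_bounds (hpos x).inv.isHermitian hν.le (hE x)
  have hdp := (hpos x).det_pos
  rw [Matrix.det_nonsing_inv, Ring.inverse_eq_inv'] at hd
  have hν3 : 0 < ν ^ 3 := by positivity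
  refine ⟨Real.sqrt_le_sqrt ?_, Real.sqrt_le_sqrt ?_⟩
  · exact inv_le_of_inv_le₀ hdp hd.2
  · exact (le_inv_comm₀ hν3 hdp).1 hd.1

theorem sq_norm_fderiv_apply_le {u : Eu 3 → ℂ} (x ω : Eu 3) (hω : ‖ω‖ = 1) :
    ‖fderiv ℝ u x ω‖ ^ 2 ≤ ∑ j, ‖pd j u x‖ ^ 2 := by
  have h1 : fderiv ℝ u x ω = ∑ j, ω j • pd j u x := by
    conv_lhs => rw [← (EuclideanSpace.basisFun (Fin 3) ℝ).sum_repr ω]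
    simp [pd]
  have h2 : ∑ j, ‖ω j‖ ^ 2 = 1 := by
    rw [← EuclideanSpace.norm_sq_eq, hω, one_pow]
  calc ‖fderiv ℝ u x ω‖ ^ 2 ≤ (∑ j, ‖ω j‖ * ‖pd j u x‖) ^ 2 := by
        rw [h1]
        gcongr
        exact (norm_sum_le _ _).trans (Finset.sum_le_sum fun j _ => (norm_smul _ _).le)
    _ ≤ (∑ j, ‖ω j‖ ^ 2) * ∑ j, ‖pd j u x‖ ^ 2 := Finset.sum_mul_sq_le_sq_mul_sq _ _ _
    _ = _ := by rw [h2, one_mul]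

theorem continuous_sum_sq_norm_pd {u : Eu 3 → ℂ} (hu : ContDiff ℝ (⊤ : ℕ∞) u) :
    Continuous fun x => ∑ j, ‖pd j u x‖ ^ 2 := by
  have h1 : Continuous (fderiv ℝ u) := hu.continuous_fderiv (by simp)
  unfold pd
  fun_prop

/-- One-dimensional estimate: `-(r|v|²)' ≤ r²|v'|²`, integrated. -/
theorem mul_sq_norm_le_add_integral {v v' : ℝ → ℂ} (hv : ∀ r, HasDerivAt v (v' r) r)
    (hv' : Continuous v') {a b : ℝ} (hab : a ≤ b) :
    a * ‖v a‖ ^ 2 ≤ b * ‖v b‖ ^ 2 + ∫ r in a..b, r ^ 2 * ‖v' r‖ ^ 2 := by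
  have hc : Continuous v := continuous_iff_continuousAt.2 fun r => (hv r).continuousAt
  have hd : ∀ r, HasDerivAt (fun r => r * ‖v r‖ ^ 2)
      (‖v r‖ ^ 2 + r * (2 * inner ℝ (v r) (v' r))) r := by
    intro r
    simpa only [id_eq, one_mul] using! (hasDerivAt_id r).mul (hv r).norm_sq
  have hcd : Continuous fun r => ‖v r‖ ^ 2 + r * (2 * inner ℝ (v r) (v' r)) := by fun_prop
  have hftc := intervalIntegral.integral_eq_sub_of_hasDerivAt (a := a) (b := b)
    (fun r _ => hd r) (hcd.intervalIntegrable _ _)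
  have hmono : ∫ r in a..b, -(‖v r‖ ^ 2 + r * (2 * inner ℝ (v r) (v' r))) ≤
      ∫ r in a..b, r ^ 2 * ‖v' r‖ ^ 2 := by
    refine intervalIntegral.integral_mono_on hab (hcd.neg.intervalIntegrable _ _)
      (Continuous.intervalIntegrable (by fun_prop) _ _) fun r _ => ?_
    have h1 := norm_add_sq_real (v r) (r • v' r)
    rw [inner_smul_right, norm_smul, mul_pow, Real.norm_eq_abs, sq_abs] at h1
    nlinarith [sq_nonneg ‖v r + r • v' r‖]
  rw [intervalIntegral.integral_neg, hftc] at hmono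
  linarith

theorem integral_sphere_sq_norm_le {u : Eu 3 → ℂ} (hu : ContDiff ℝ (⊤ : ℕ∞) u) {R : ℝ}
    (hR : 0 < R) (hR1 : R ≤ 1) :
    R ^ 2 * ∫ ω : Metric.sphere (0 : Eu 3) 1, ‖u (R • (ω : Eu 3))‖ ^ 2 ∂(volume.toSphere) ≤
      2 * (∫ ω : Metric.sphere (0 : Eu 3) 1, ‖u ((2 : ℝ) • (ω : Eu 3))‖ ^ 2 ∂(volume.toSphere))
        + ∫ x in Metric.ball (0 : Eu 3) 2, ∑ j, ‖pd j u x‖ ^ 2 := by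
  have hF := continuous_sum_sq_norm_pd hu
  have huc := hu.continuous
  have huf : Continuous (fderiv ℝ u) := hu.continuous_fderiv (by simp)
  have hcs : ∀ r : ℝ, Integrable (fun ω : Metric.sphere (0 : Eu 3) 1 =>
      ‖u (r • (ω : Eu 3))‖ ^ 2) volume.toSphere := fun r =>
    Continuous.integrable_of_hasCompactSupport (by fun_prop) (HasCompactSupport.of_compactSpace _)
  have hci : Integrable (fun ω : Metric.sphere (0 : Eu 3) 1 =>
      ∫ r in (0 : ℝ)..2, r ^ 2 * ∑ j, ‖pd j u (r • (ω : Eu 3))‖ ^ 2) volume.toSphere := by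
    refine Continuous.integrable_of_hasCompactSupport ?_ (HasCompactSupport.of_compactSpace _)
    apply intervalIntegral.continuous_parametric_intervalIntegral_of_continuous'
      (f := fun (ω : Metric.sphere (0 : Eu 3) 1) (r : ℝ) =>
        r ^ 2 * ∑ j, ‖pd j u (r • (ω : Eu 3))‖ ^ 2)
    have h1 : Continuous fun p : Metric.sphere (0 : Eu 3) 1 × ℝ => p.2 • (p.1 : Eu 3) := by
      fun_prop
    exact (continuous_snd.pow 2).mul (hF.comp h1)
  rw [setIntegral_ball_eq_integral_toSphere hF zero_le_two, ← integral_const_mul,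
    ← integral_const_mul, ← integral_add ((hcs 2).const_mul 2) hci]
  refine integral_mono ((hcs R).const_mul _) (((hcs 2).const_mul 2).add hci) fun ω => ?_
  have hω : ‖(ω : Eu 3)‖ = 1 := by simp
  have hline : Continuous fun r : ℝ => r • (ω : Eu 3) := by fun_prop
  have hFl : Continuous fun r : ℝ => r ^ 2 * ∑ j, ‖pd j u (r • (ω : Eu 3))‖ ^ 2 :=
    (continuous_id.pow 2).mul (hF.comp hline)
  have hder : ∀ r : ℝ, HasDerivAt (fun r : ℝ => u (r • (ω : Eu 3)))
      (fderiv ℝ u (r • (ω : Eu 3)) ω) r := by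
    intro r
    have h1 : HasDerivAt (fun r : ℝ => r • (ω : Eu 3)) (ω : Eu 3) r := by
      simpa using (hasDerivAt_id r).smul_const (ω : Eu 3)
    exact ((hu.differentiable (by simp)) _).hasFDerivAt.comp_hasDerivAt r h1
  have hcd : Continuous fun r : ℝ => fderiv ℝ u (r • (ω : Eu 3)) ω := by fun_prop
  have h1 := mul_sq_norm_le_add_integral hder hcd (show R ≤ 2 by linarith)
  have h2 : ∫ r in R..2, r ^ 2 * ‖fderiv ℝ u (r • (ω : Eu 3)) ω‖ ^ 2 ≤
      ∫ r in R..2, r ^ 2 * ∑ j, ‖pd j u (r • (ω : Eu 3))‖ ^ 2 := by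
    refine intervalIntegral.integral_mono_on (by linarith)
      (Continuous.intervalIntegrable (by fun_prop) _ _) (hFl.intervalIntegrable _ _) fun r _ => ?_
    exact mul_le_mul_of_nonneg_left (sq_norm_fderiv_apply_le _ _ hω) (sq_nonneg r)
  have h3 : ∫ r in R..2, r ^ 2 * ∑ j, ‖pd j u (r • (ω : Eu 3))‖ ^ 2 ≤
      ∫ r in (0 : ℝ)..2, r ^ 2 * ∑ j, ‖pd j u (r • (ω : Eu 3))‖ ^ 2 :=
    intervalIntegral.integral_mono_interval hR.le (by linarith) le_rfl
      (.of_forall fun r => by positivity) (hFl.intervalIntegrable _ _)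
  have h4 : R ^ 2 * ‖u (R • (ω : Eu 3))‖ ^ 2 ≤ R * ‖u (R • (ω : Eu 3))‖ ^ 2 := by
    gcongr
    nlinarith
  simp only
  linarith

theorem continuous_sdet {h : Eu 3 → Matrix (Fin 3) (Fin 3) ℝ}
    (hh : ∀ j k : Fin 3, ContDiff ℝ (⊤ : ℕ∞) fun x => h x j k) : Continuous (sdet h) :=
  ((continuous_matrix fun j k => (hh j k).continuous).matrix_det).sqrt

/-- An element of the family is bounded by a supremum restricted by a predicate. -/
theorem le_ciSup_prop_of_bounded {P : ℝ → Prop} {f : ℝ → ℝ} {B : ℝ} (hB : ∀ r, P r → f r ≤ B)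
    (hB0 : 0 ≤ B) {r : ℝ} (hr : P r) : f r ≤ ⨆ s : ℝ, ⨆ _ : P s, f s := by
  have hbdd : BddAbove (range fun s : ℝ => ⨆ _ : P s, f s) :=
    ⟨B, by rintro _ ⟨s, rfl⟩; exact Real.iSup_le (fun hs => hB s hs) hB0⟩
  refine le_trans ?_ (le_ciSup hbdd r)
  rw [ciSup_pos hr]

/-- `‖u‖²_X ≤ C ( sup_{R>1} R⁻² ∫_{S_R} |u|² √det h dS + ‖∇u‖²_Y )`. -/
theorem stmt10 (ν N : ℝ) (hν : 0 < ν) (hνN : ν ≤ N) :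
    ∃ C > (0 : ℝ),
      ∀ h : Eu 3 → Matrix (Fin 3) (Fin 3) ℝ,
        (∀ j k : Fin 3, ContDiff ℝ (⊤ : ℕ∞) fun x => h x j k) →
        (∀ x, (h x).IsSymm) → (∀ x, (h x).PosDef) →
        Elliptic h ν N →
        ∀ u : Eu 3 → ℂ, ContDiff ℝ (⊤ : ℕ∞) u → HasCompactSupport u →
          Xsq h (fun x => ‖u x‖ ^ 2)
            ≤ C * ((⨆ R : ℝ, ⨆ _ : 1 < R,
                      (R ^ 2)⁻¹ * sphInt (fun x => ‖u x‖ ^ 2 * sdet h x) R)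
                + Ysq h (fun x => ∑ j, ‖pd j u x‖ ^ 2)) := by
  obtain ⟨m, hm⟩ : ∃ m, m = √((N ^ 3)⁻¹) := ⟨_, rfl⟩
  obtain ⟨M, hM⟩ : ∃ M, M = √((ν ^ 3)⁻¹) := ⟨_, rfl⟩
  have hN : 0 < N := hν.trans_le hνN
  have hm0 : 0 < m := by rw [hm]; positivity
  have hM0 : 0 < M := by rw [hM]; positivity
  refine ⟨3 * (M / m) + 1, by positivity, ?_⟩
  intro h hsm _ hpos hE u hu hcu
  have hlow : ∀ x, m ≤ sdet h x := fun x => hm ▸ (sdet_bounds hν hpos hE x).1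
  have hupp : ∀ x, sdet h x ≤ M := fun x => hM ▸ (sdet_bounds hν hpos hE x).2
  have hs0 : ∀ x, 0 ≤ sdet h x := fun x => hm0.le.trans (hlow x)
  have hsc := continuous_sdet hsm
  have huc := hu.continuous
  have hF := continuous_sum_sq_norm_pd hu
  have hF0 : ∀ x, 0 ≤ ∑ j, ‖pd j u x‖ ^ 2 := fun x => by positivity
  have hFs : HasCompactSupport fun x => ∑ j, ‖pd j u x‖ ^ 2 := by
    refine (hcu.fderiv ℝ).mono' ?_
    refine Function.support_subset_iff'.2 fun x hx => ?_
    simp [pd, image_eq_zero_of_notMem_tsupport hx]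
  set S : ℝ := ⨆ R : ℝ, ⨆ _ : 1 < R, (R ^ 2)⁻¹ * sphInt (fun x => ‖u x‖ ^ 2 * sdet h x) R with hS
  set Y : ℝ := Ysq h (fun x => ∑ j, ‖pd j u x‖ ^ 2) with hY
  have hsph : ∀ r : ℝ, 0 < r → (r ^ 2)⁻¹ * sphInt (fun x => ‖u x‖ ^ 2 * sdet h x) r =
      ∫ ω : Metric.sphere (0 : Eu 3) 1,
        ‖u (r • (ω : Eu 3))‖ ^ 2 * sdet h (r • (ω : Eu 3)) ∂(volume.toSphere) := by
    intro r hr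
    rw [sphInt, inv_mul_cancel_left₀ (by positivity)]
  have hint1 : ∀ r : ℝ, Integrable (fun ω : Metric.sphere (0 : Eu 3) 1 =>
      ‖u (r • (ω : Eu 3))‖ ^ 2 * sdet h (r • (ω : Eu 3))) volume.toSphere := fun r =>
    Continuous.integrable_of_hasCompactSupport (by fun_prop) (HasCompactSupport.of_compactSpace _)
  have hint2 : ∀ r : ℝ, Integrable (fun ω : Metric.sphere (0 : Eu 3) 1 =>
      ‖u (r • (ω : Eu 3))‖ ^ 2) volume.toSphere := fun r =>
    Continuous.integrable_of_hasCompactSupport (by fun_prop) (HasCompactSupport.of_compactSpace _)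
  have hsph0 : ∀ r, 0 ≤ sphInt (fun x => ‖u x‖ ^ 2 * sdet h x) r := fun r =>
    mul_nonneg (sq_nonneg r) (integral_nonneg fun ω => mul_nonneg (sq_nonneg _) (hs0 _))
  obtain ⟨K, hK⟩ := hcu.exists_bound_of_continuous huc
  have hSle : ∀ r : ℝ, 1 < r →
      (r ^ 2)⁻¹ * sphInt (fun x => ‖u x‖ ^ 2 * sdet h x) r ≤ S := by
    intro r hr
    refine le_ciSup_prop_of_bounded
      (B := ∫ ω : Metric.sphere (0 : Eu 3) 1, K ^ 2 * M ∂(volume.toSphere)) (P := fun r => 1 < r)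
      (f := fun r => (r ^ 2)⁻¹ * sphInt (fun x => ‖u x‖ ^ 2 * sdet h x) r)
      (fun r hr => ?_) (integral_nonneg fun ω => by positivity) hr
    rw [hsph r (by linarith)]
    refine integral_mono (hint1 r) (integrable_const _) fun ω => ?_
    have h1 := hK (r • (ω : Eu 3))
    have h2 := hupp (r • (ω : Eu 3))
    have h3 := hs0 (r • (ω : Eu 3))
    dsimp only
    gcongr
  have hFint : Integrable (fun x => (∑ j, ‖pd j u x‖ ^ 2) * sdet h x) :=
    Continuous.integrable_of_hasCompactSupport (hF.mul hsc) hFs.mul_right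
  have hFnn : ∀ x, 0 ≤ (∑ j, ‖pd j u x‖ ^ 2) * sdet h x := fun x => mul_nonneg (hF0 x) (hs0 x)
  have hYle : (√(1 + 2 ^ 2))⁻¹ *
      ∫ x in Metric.ball (0 : Eu 3) 2, (∑ j, ‖pd j u x‖ ^ 2) * sdet h x ≤ Y := by
    refine le_ciSup_prop_of_bounded (P := fun r => 0 < r)
      (B := ∫ x, (∑ j, ‖pd j u x‖ ^ 2) * sdet h x)
      (f := fun r => (√(1 + r ^ 2))⁻¹ *
        ∫ x in Metric.ball (0 : Eu 3) r, (∑ j, ‖pd j u x‖ ^ 2) * sdet h x)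
      (fun r hr => ?_) (integral_nonneg hFnn) zero_lt_two
    have h1 : 1 ≤ √(1 + r ^ 2) := Real.one_le_sqrt.2 (by nlinarith)
    calc _ ≤ 1 * ∫ x in Metric.ball (0 : Eu 3) r, (∑ j, ‖pd j u x‖ ^ 2) * sdet h x :=
          mul_le_mul_of_nonneg_right (inv_le_one_of_one_le₀ h1) (integral_nonneg hFnn)
      _ ≤ _ := by
          rw [one_mul]
          exact setIntegral_le_integral hFint (.of_forall hFnn)
  have hS0 : 0 ≤ S := (mul_nonneg (by positivity) (hsph0 2)).trans (hSle 2 one_lt_two)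
  have hY0 : 0 ≤ Y := (mul_nonneg (by positivity) (integral_nonneg hFnn)).trans hYle
  have hMm : 0 ≤ M / m := by positivity
  have hrhs : 0 ≤ (3 * (M / m) + 1) * (S + Y) := by positivity
  refine Real.iSup_le (fun R => Real.iSup_le (fun hR => ?_) hrhs) hrhs
  rcases lt_or_ge 1 R with hR1 | hR1
  · calc (1 + R ^ 2)⁻¹ * sphInt (fun x => ‖u x‖ ^ 2 * sdet h x) R
        ≤ (R ^ 2)⁻¹ * sphInt (fun x => ‖u x‖ ^ 2 * sdet h x) R := by
          refine mul_le_mul_of_nonneg_right ?_ (hsph0 R)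
          gcongr
          linarith
      _ ≤ S := hSle R hR1
      _ ≤ (3 * (M / m) + 1) * (S + Y) := by nlinarith [mul_nonneg hMm (add_nonneg hS0 hY0)]
  · have hA : m * ∫ ω : Metric.sphere (0 : Eu 3) 1,
        ‖u ((2 : ℝ) • (ω : Eu 3))‖ ^ 2 ∂(volume.toSphere) ≤ S := by
      refine le_trans ?_ (hSle 2 one_lt_two)
      rw [hsph 2 two_pos, ← integral_const_mul]
      refine integral_mono ((hint2 2).const_mul m) (hint1 2) fun ω => ?_
      dsimp only
      rw [mul_comm]
      exact mul_le_mul_of_nonneg_left (hlow _) (sq_nonneg _)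
    have hB : m * ∫ x in Metric.ball (0 : Eu 3) 2, ∑ j, ‖pd j u x‖ ^ 2 ≤ 3 * Y := by
      have h5 : √(1 + 2 ^ 2) ≤ 3 := Real.sqrt_le_iff.2 ⟨by norm_num, by norm_num⟩
      rw [inv_mul_le_iff₀ (by positivity)] at hYle
      refine le_trans ?_ (hYle.trans (mul_le_mul_of_nonneg_right h5 hY0))
      rw [← integral_const_mul]
      refine integral_mono
        ((hF.integrable_of_hasCompactSupport hFs).integrableOn.const_mul m)
        hFint.integrableOn fun x => ?_
      dsimp only
      rw [mul_comm]
      exact mul_le_mul_of_nonneg_left (hlow _) (hF0 x)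
    have hD : sphInt (fun x => ‖u x‖ ^ 2 * sdet h x) R ≤ M * (R ^ 2 *
        ∫ ω : Metric.sphere (0 : Eu 3) 1, ‖u (R • (ω : Eu 3))‖ ^ 2 ∂(volume.toSphere)) := by
      rw [sphInt, mul_left_comm, ← integral_const_mul M]
      refine mul_le_mul_of_nonneg_left ?_ (sq_nonneg R)
      refine integral_mono (hint1 R) ((hint2 R).const_mul M) fun ω => ?_
      dsimp only
      rw [mul_comm M]
      exact mul_le_mul_of_nonneg_left (hupp _) (sq_nonneg _)
    have hcore := integral_sphere_sq_norm_le hu hR hR1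
    have h1 : (1 + R ^ 2)⁻¹ ≤ 1 := inv_le_one_of_one_le₀ (by nlinarith)
    calc (1 + R ^ 2)⁻¹ * sphInt (fun x => ‖u x‖ ^ 2 * sdet h x) R
        ≤ 1 * sphInt (fun x => ‖u x‖ ^ 2 * sdet h x) R :=
          mul_le_mul_of_nonneg_right h1 (hsph0 R)
      _ ≤ M * _ := by rw [one_mul]; exact hD.trans (mul_le_mul_of_nonneg_left hcore hM0.le)
      _ = M / m * (2 * (m * ∫ ω : Metric.sphere (0 : Eu 3) 1,
            ‖u ((2 : ℝ) • (ω : Eu 3))‖ ^ 2 ∂(volume.toSphere)) +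
            m * ∫ x in Metric.ball (0 : Eu 3) 2, ∑ j, ‖pd j u x‖ ^ 2) := by
          field_simp
      _ ≤ M / m * (3 * (S + Y)) := mul_le_mul_of_nonneg_left (by linarith) hMm
      _ ≤ (3 * (M / m) + 1) * (S + Y) := by linarith [add_nonneg hS0 hY0]
end
end
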